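/- Let q be a real number with 0 < q < 1. For every natural number n, the bilateral sum ∑_{k ∈ ℤ} q^{k²/2 + (n+1)k} converges and equals q^{(1 - (n+1)²)/2} · (-q^{3/2};q)_∞ · (-q^{-1/2};q)_∞ · (q;q)_∞. Equivalently, the n-th moment of the discrete Stieltjes–Wigert measure, μ_n = (1/(√q · M)) ∑_{k ∈ ℤ} q^{nk} · q^{k + k²/2} with M = (-q^{3/2};q)_∞ (-q^{-1/2};q)_∞ (q;q)_∞, equals q^{-(n+1)²/2}. -/

import Mathlib

open scoped BigOperators

/-- The infinite q-Pochhammer symbol `(a;q)_∞ = ∏_{k=0}^{∞} (1 - a q^k)`. -/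
noncomputable def qPochInf (a q : ℝ) : ℝ := ∏' k : ℕ, (1 - a * q ^ k)

open Filter Topology Finset

/-- The Gaussian binomial coefficient, defined by the `q`-Pascal recursion. -/
def gaussBinom (q : ℝ) : ℕ → ℕ → ℝ
  | _, 0 => 1
  | 0, _ + 1 => 0
  | N + 1, k + 1 => gaussBinom q N (k + 1) + q ^ (N - k) * gaussBinom q N k

/-- The finite `q`-Pochhammer symbol `(q;q)_n`. -/
def qPoch (q : ℝ) (n : ℕ) : ℝ := ∏ i ∈ range n, (1 - q * q ^ i)

lemma gaussBinom_zero_right (q : ℝ) (N : ℕ) : gaussBinom q N 0 = 1 := by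
  cases N <;> rfl

lemma gaussBinom_succ_succ (q : ℝ) (N k : ℕ) :
    gaussBinom q (N + 1) (k + 1) = gaussBinom q N (k + 1) + q ^ (N - k) * gaussBinom q N k :=
  rfl

lemma gaussBinom_eq_zero (q : ℝ) {N k : ℕ} (h : N < k) : gaussBinom q N k = 0 := by
  induction N generalizing k with
  | zero => cases k with
    | zero => omega
    | succ k => rfl
  | succ N ih => cases k with
    | zero => omega
    | succ k => rw [gaussBinom_succ_succ, ih (by omega), ih (by omega)]; ring

lemma qPoch_succ (q : ℝ) (n : ℕ) : qPoch q (n + 1) = qPoch q n * (1 - q * q ^ n) :=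
  prod_range_succ _ _

lemma qPoch_zero (q : ℝ) : qPoch q 0 = 1 := prod_range_zero _

lemma gaussBinom_mul_qPoch (q : ℝ) (a b : ℕ) :
    gaussBinom q (a + b) a * (qPoch q a * qPoch q b) = qPoch q (a + b) := by
  induction a generalizing b with
  | zero => simp [gaussBinom_zero_right, qPoch_zero]
  | succ a iha =>
    induction b with
    | zero =>
      have h := iha 0
      simp only [add_zero, qPoch_zero, mul_one] at h ⊢
      rw [gaussBinom_succ_succ, gaussBinom_eq_zero q (Nat.lt_add_one a), qPoch_succ, Nat.sub_self]
      linear_combination (1 - q * q ^ a) * h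
    | succ b ihb =>
      have h := iha (b + 1)
      have e : a + 1 + (b + 1) = (a + b + 1) + 1 := by ring
      have e' : a + b + 1 - a = b + 1 := by omega
      rw [show a + 1 + b = a + b + 1 by ring] at ihb
      rw [show a + (b + 1) = a + b + 1 by ring] at h
      rw [e, gaussBinom_succ_succ, e', qPoch_succ q (a + b + 1)]
      rw [qPoch_succ q a, qPoch_succ q b] at *
      linear_combination (1 - q * q ^ b) * ihb + q ^ (b + 1) * (1 - q * q ^ a) * h

/-- The finite `q`-binomial theorem. -/
lemma prod_add_mul_pow (q x y : ℝ) (N : ℕ) :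
    ∏ i ∈ range N, (y + x * q ^ i) =
      ∑ k ∈ range (N + 1), gaussBinom q N k * q ^ (k.choose 2) * x ^ k * y ^ (N - k) := by
  induction N with
  | zero => simp [gaussBinom_zero_right]
  | succ N ih =>
    rw [prod_range_succ, ih, mul_add, sum_range_succ' _ (N + 1)]
    have h1 : (∑ k ∈ range (N + 1), gaussBinom q N k * q ^ (k.choose 2) * x ^ k * y ^ (N - k)) * y
        = (∑ k ∈ range (N + 1),
            gaussBinom q N (k + 1) * q ^ ((k + 1).choose 2) * x ^ (k + 1) * y ^ (N - k))
          + y ^ (N + 1) := by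
      rw [sum_range_succ' _ N, sum_range_succ _ N, gaussBinom_eq_zero q (Nat.lt_add_one N),
        add_mul, sum_mul]
      simp only [gaussBinom_zero_right, zero_mul, add_zero]
      congr 1
      · refine sum_congr rfl fun k hk => ?_
        have : N - k = (N - (k + 1)) + 1 := by have := mem_range.1 hk; omega
        rw [this]
        ring
      · simp [pow_succ]
    rw [h1, sum_mul, add_right_comm, ← sum_add_distrib]
    congr 1
    · refine sum_congr rfl fun k hk => ?_
      have hk' : k ≤ N := by have := mem_range.1 hk; omega
      rw [gaussBinom_succ_succ, Nat.add_sub_add_right,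
        show (k + 1).choose 2 = k + k.choose 2 by simp [Nat.choose_succ_succ' k 1]]
      obtain ⟨d, rfl⟩ := Nat.exists_eq_add_of_le hk'
      rw [Nat.add_sub_cancel_left]
      ring
    · simp [gaussBinom_zero_right]

lemma two_mul_choose_two_add (k : ℕ) : 2 * k.choose 2 + k = k ^ 2 := by
  induction k with
  | zero => rfl
  | succ k ih =>
    rw [Nat.choose_succ_succ' k 1, Nat.choose_one_right]
    linarith

/-- The finite form of the Jacobi triple product at `z = 1`. -/
lemma sq_prod_one_add_eq_sum {p : ℝ} (hp : 0 < p) (n : ℕ) :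
    (∏ i ∈ range n, (1 + p * (p ^ 2) ^ i)) ^ 2 =
      ∑ k ∈ range (2 * n + 1), gaussBinom (p ^ 2) (2 * n) k * p ^ (((k : ℤ) - n).natAbs ^ 2) := by
  have hsum : ∑ i ∈ range n, (2 * i + 1) = n ^ 2 := by
    induction n with
    | zero => rfl
    | succ n ih => rw [sum_range_succ, ih]; ring
  have hL : ∏ i ∈ range (2 * n), (p ^ (2 * n) + p * (p ^ 2) ^ i) =
      p ^ (3 * n ^ 2) * (∏ i ∈ range n, (1 + p * (p ^ 2) ^ i)) ^ 2 := by
    rw [two_mul n, prod_range_add, ← two_mul]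
    have h1 : ∏ i ∈ range n, (p ^ (2 * n) + p * (p ^ 2) ^ i) =
        p ^ (n ^ 2) * ∏ i ∈ range n, (1 + p * (p ^ 2) ^ i) := by
      rw [← prod_range_reflect (fun i => 1 + p * (p ^ 2) ^ i), ← hsum,
        ← prod_pow_eq_pow_sum, ← prod_mul_distrib]
      refine prod_congr rfl fun i hi => ?_
      obtain ⟨d, rfl⟩ := Nat.exists_eq_add_of_lt (mem_range.1 hi)
      rw [show i + d + 1 - 1 - i = d by omega]
      ring
    have h2 : ∏ i ∈ range n, (p ^ (2 * n) + p * (p ^ 2) ^ (n + i)) =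
        p ^ (2 * n ^ 2) * ∏ i ∈ range n, (1 + p * (p ^ 2) ^ i) := by
      have : p ^ (2 * n ^ 2) = ∏ _i ∈ range n, p ^ (2 * n) := by
        rw [prod_const, card_range]; ring
      rw [this, ← prod_mul_distrib]
      refine prod_congr rfl fun i _ => ?_
      ring
    rw [h1, h2]
    ring
  have hpos : p ^ (3 * n ^ 2) ≠ 0 := (pow_pos hp _).ne'
  refine mul_left_cancel₀ hpos ?_
  rw [← hL, prod_add_mul_pow, mul_sum]
  refine sum_congr rfl fun k hk => ?_
  have hexp : 2 * k.choose 2 + k + 2 * n * (2 * n - k) =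
      3 * n ^ 2 + ((k : ℤ) - n).natAbs ^ 2 := by
    have hk' : k ≤ 2 * n := by have := mem_range.1 hk; omega
    rw [two_mul_choose_two_add]
    zify [hk']
    rw [sq_abs]
    ring
  have : (p ^ 2) ^ (k.choose 2) * p ^ k * (p ^ (2 * n)) ^ (2 * n - k) =
      p ^ (3 * n ^ 2) * p ^ (((k : ℤ) - n).natAbs ^ 2) := by
    rw [← pow_add, ← hexp, ← pow_mul, ← pow_mul, ← pow_add, ← pow_add]
  linear_combination gaussBinom (p ^ 2) (2 * n) k * this

lemma multipliable_qPochInf (a : ℝ) {q : ℝ} (hq0 : 0 < q) (hq1 : q < 1) :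
    Multipliable fun k : ℕ => 1 - a * q ^ k := by
  have h : Summable fun k : ℕ => -(a * q ^ k) :=
    ((summable_geometric_of_lt_one hq0.le hq1).mul_left a).neg
  simpa [sub_eq_add_neg] using Real.multipliable_one_add_of_summable h

lemma qPochInf_ne_zero {a q : ℝ} (hq0 : 0 < q) (hq1 : q < 1) (h : ∀ k : ℕ, 1 - a * q ^ k ≠ 0) :
    qPochInf a q ≠ 0 := by
  have hs : Summable fun k : ℕ => -(a * q ^ k) :=
    ((summable_geometric_of_lt_one hq0.le hq1).mul_left a).neg
  have := tprod_one_add_ne_zero_of_summable (f := fun k : ℕ => -(a * q ^ k))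
    (by simpa [sub_eq_add_neg] using h) hs.norm
  simpa [qPochInf, sub_eq_add_neg] using this

lemma qPochInf_eq_mul (a : ℝ) {q : ℝ} (hq0 : 0 < q) (hq1 : q < 1) :
    qPochInf a q = (1 - a) * qPochInf (a * q) q := by
  have h := (multipliable_qPochInf (a * q) hq0 hq1)
  rw [qPochInf, tprod_eq_zero_mul' (by simpa [pow_succ', mul_assoc] using h), qPochInf]
  simp [pow_succ', mul_assoc]

lemma tendsto_prod_qPochInf (a : ℝ) {q : ℝ} (hq0 : 0 < q) (hq1 : q < 1) :
    Tendsto (fun n => ∏ i ∈ range n, (1 - a * q ^ i)) atTop (𝓝 (qPochInf a q)) :=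
  (multipliable_qPochInf a hq0 hq1).hasProd.tendsto_prod_nat

lemma one_sub_mul_pow_pos {q : ℝ} (hq0 : 0 < q) (hq1 : q < 1) (n : ℕ) : 0 < 1 - q * q ^ n := by
  rw [← pow_succ']
  exact sub_pos.2 (pow_lt_one₀ hq0.le hq1 n.succ_ne_zero)

lemma qPoch_pos {q : ℝ} (hq0 : 0 < q) (hq1 : q < 1) (n : ℕ) : 0 < qPoch q n :=
  prod_pos fun i _ => one_sub_mul_pow_pos hq0 hq1 i

lemma qPoch_antitone {q : ℝ} (hq0 : 0 < q) (hq1 : q < 1) : Antitone (qPoch q) := by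
  refine antitone_nat_of_succ_le fun n => ?_
  rw [qPoch_succ]
  exact mul_le_of_le_one_right (qPoch_pos hq0 hq1 n).le (sub_le_self _ (by positivity))

lemma tendsto_qPoch {q : ℝ} (hq0 : 0 < q) (hq1 : q < 1) :
    Tendsto (qPoch q) atTop (𝓝 (qPochInf q q)) :=
  tendsto_prod_qPochInf q hq0 hq1

lemma qPochInf_le_qPoch {q : ℝ} (hq0 : 0 < q) (hq1 : q < 1) (n : ℕ) : qPochInf q q ≤ qPoch q n :=
  (qPoch_antitone hq0 hq1).le_of_tendsto (tendsto_qPoch hq0 hq1) n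

lemma qPochInf_self_pos {q : ℝ} (hq0 : 0 < q) (hq1 : q < 1) : 0 < qPochInf q q :=
  (ge_of_tendsto' (tendsto_qPoch hq0 hq1) fun n => (qPoch_pos hq0 hq1 n).le).lt_of_ne'
    (qPochInf_ne_zero hq0 hq1 fun k => (one_sub_mul_pow_pos hq0 hq1 k).ne')

lemma gaussBinom_eq_div {q : ℝ} (hq0 : 0 < q) (hq1 : q < 1) (a b : ℕ) :
    gaussBinom q (a + b) a = qPoch q (a + b) / (qPoch q a * qPoch q b) := by
  rw [eq_div_iff (mul_pos (qPoch_pos hq0 hq1 a) (qPoch_pos hq0 hq1 b)).ne']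
  exact gaussBinom_mul_qPoch q a b

lemma abs_gaussBinom_le {q : ℝ} (hq0 : 0 < q) (hq1 : q < 1) (N k : ℕ) :
    |gaussBinom q N k| ≤ 1 / qPochInf q q ^ 2 := by
  have hQ := qPochInf_self_pos hq0 hq1
  rcases lt_or_ge N k with h | h
  · rw [gaussBinom_eq_zero q h, abs_zero]
    positivity
  · obtain ⟨d, rfl⟩ := Nat.exists_eq_add_of_le h
    have hk := qPoch_pos hq0 hq1 k
    have hd := qPoch_pos hq0 hq1 d
    have hkd := qPoch_pos hq0 hq1 (k + d)
    rw [gaussBinom_eq_div hq0 hq1, abs_of_pos (by positivity), sq]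
    have h1 : qPoch q (k + d) ≤ 1 :=
      (qPoch_antitone hq0 hq1 (Nat.zero_le _)).trans (qPoch_zero q).le
    have hk' := qPochInf_le_qPoch hq0 hq1 k
    have hd' := qPochInf_le_qPoch hq0 hq1 d
    gcongr

lemma tendsto_gaussBinom_central {q : ℝ} (hq0 : 0 < q) (hq1 : q < 1) (k : ℤ) :
    Tendsto (fun n : ℕ => gaussBinom q (2 * n) (k + n).toNat) atTop (𝓝 (1 / qPochInf q q)) := by
  have hQ := qPochInf_self_pos hq0 hq1
  have hT := tendsto_qPoch hq0 hq1
  have t1 : Tendsto (fun n : ℕ => 2 * n) atTop atTop :=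
    tendsto_atTop_mono (fun n => by simp only [id]; omega) tendsto_id
  have t2 (k : ℤ) : Tendsto (fun n : ℕ => (k + n).toNat) atTop atTop :=
    tendsto_atTop_mono (fun n => by omega) (tendsto_sub_atTop_nat k.natAbs)
  have h := (hT.comp t1).div ((hT.comp (t2 k)).mul (hT.comp (t2 (-k)))) (mul_pos hQ hQ).ne'
  rw [show 1 / qPochInf q q = qPochInf q q / (qPochInf q q * qPochInf q q) by field_simp]
  refine h.congr' ?_
  filter_upwards [eventually_ge_atTop k.natAbs] with n hn
  have e : 2 * n = (k + n).toNat + (-k + n).toNat := by omega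
  simp only [Function.comp, Pi.div_apply]
  rw [e, gaussBinom_eq_div hq0 hq1]

lemma summable_pow_natAbs_sq {p : ℝ} (hp0 : 0 < p) (hp1 : p < 1) :
    Summable fun k : ℤ => p ^ (k.natAbs ^ 2) := by
  have h : Summable fun n : ℕ => p ^ (n ^ 2) :=
    (summable_geometric_of_lt_one hp0.le hp1).of_nonneg_of_le (fun _ => by positivity)
      fun n => pow_le_pow_of_le_one hp0.le hp1.le (Nat.le_self_pow two_ne_zero n)
  exact Summable.of_nat_of_neg (by simpa using h) (by simpa using h)

/-- The Jacobi triple product identity at `z = 1`. -/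
theorem hasSum_pow_natAbs_sq {p : ℝ} (hp0 : 0 < p) (hp1 : p < 1) :
    HasSum (fun k : ℤ => p ^ (k.natAbs ^ 2))
      (qPochInf (-p) (p ^ 2) ^ 2 * qPochInf (p ^ 2) (p ^ 2)) := by
  have hq0 : 0 < p ^ 2 := by positivity
  have hq1 : p ^ 2 < 1 := pow_lt_one₀ hp0.le hp1 two_ne_zero
  have hQ := qPochInf_self_pos hq0 hq1
  have hS := summable_pow_natAbs_sq hp0 hp1
  set f : ℕ → ℤ → ℝ := fun n k =>
    if -(n : ℤ) ≤ k then gaussBinom (p ^ 2) (2 * n) (k + n).toNat * p ^ (k.natAbs ^ 2) else 0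
    with hf
  have hfsum (n : ℕ) : ∑' k, f n k = (∏ i ∈ range n, (1 + p * (p ^ 2) ^ i)) ^ 2 := by
    have hinj : Function.Injective fun k : ℕ => (k : ℤ) - n := fun a b h => by
      simpa using h
    rw [sq_prod_one_add_eq_sum hp0, tsum_eq_sum (s := (range (2 * n + 1)).map ⟨_, hinj⟩), sum_map]
    · refine sum_congr rfl fun k _ => ?_
      simp [hf]
    · intro k hk
      simp only [hf]
      split_ifs with h
      · rw [gaussBinom_eq_zero, zero_mul]
        by_contra! hle
        refine hk (mem_map.2 ⟨(k + n).toNat, mem_range.2 (by omega), ?_⟩)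
        simp only [Function.Embedding.coeFn_mk]
        omega
      · rfl
  have hlim : Tendsto (fun n => ∑' k, f n k) atTop
      (𝓝 (∑' k : ℤ, 1 / qPochInf (p ^ 2) (p ^ 2) * p ^ (k.natAbs ^ 2))) := by
    refine tendsto_tsum_of_dominated_convergence
      (hS.mul_left (1 / qPochInf (p ^ 2) (p ^ 2) ^ 2)) (fun k => ?_) (.of_forall fun n k => ?_)
    · refine ((tendsto_gaussBinom_central hq0 hq1 k).mul_const _).congr' ?_
      filter_upwards [eventually_ge_atTop k.natAbs] with n hn
      simp only [hf]
      rw [if_pos (by omega)]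
    · simp only [hf]
      split_ifs
      · rw [norm_mul, Real.norm_eq_abs, Real.norm_of_nonneg (by positivity)]
        gcongr
        exact abs_gaussBinom_le hq0 hq1 _ _
      · rw [norm_zero]
        positivity
  have hlim' : Tendsto (fun n => ∑' k, f n k) atTop (𝓝 (qPochInf (-p) (p ^ 2) ^ 2)) := by
    refine ((tendsto_prod_qPochInf (-p) hq0 hq1).pow 2).congr fun n => ?_
    rw [hfsum]
    simp
  have h := tendsto_nhds_unique hlim' hlim
  rw [tsum_mul_left] at h
  rw [h, one_div, mul_right_comm, inv_mul_cancel₀ hQ.ne', one_mul]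
  exact hS.hasSum

lemma qPochInf_mul_qPochInf {q : ℝ} (hq0 : 0 < q) (hq1 : q < 1) :
    qPochInf (-(q ^ ((3 : ℝ) / 2))) q * qPochInf (-(q ^ (-(1 : ℝ) / 2))) q =
      q ^ (-(1 : ℝ) / 2) * qPochInf (-(q ^ ((1 : ℝ) / 2))) q ^ 2 := by
  have e1 : -(q ^ (-(1 : ℝ) / 2)) * q = -(q ^ ((1 : ℝ) / 2)) := by
    rw [neg_mul, ← Real.rpow_add_one hq0.ne']
    norm_num
  have e2 : -(q ^ ((1 : ℝ) / 2)) * q = -(q ^ ((3 : ℝ) / 2)) := by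
    rw [neg_mul, ← Real.rpow_add_one hq0.ne']
    norm_num
  have e3 : q ^ (-(1 : ℝ) / 2) * q ^ ((1 : ℝ) / 2) = 1 := by
    rw [← Real.rpow_add hq0]
    norm_num
  have h1 := qPochInf_eq_mul (-(q ^ (-(1 : ℝ) / 2))) hq0 hq1
  have h2 := qPochInf_eq_mul (-(q ^ ((1 : ℝ) / 2))) hq0 hq1
  rw [e1] at h1
  rw [e2] at h2
  rw [h1]
  linear_combination (-q ^ (-(1 : ℝ) / 2) * qPochInf (-(q ^ ((1 : ℝ) / 2))) q) * h2 +
    (- qPochInf (-(q ^ ((1 : ℝ) / 2))) q * qPochInf (-(q ^ ((3 : ℝ) / 2))) q) * e3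

/-- The bilateral sum `∑_{k ∈ ℤ} q^{k²/2 + (n+1)k}` converges and equals
`q^{(1-(n+1)²)/2} (-q^{3/2};q)_∞ (-q^{-1/2};q)_∞ (q;q)_∞`; equivalently, the `n`-th moment
of the discrete Stieltjes–Wigert measure equals `q^{-(n+1)²/2}`. -/
theorem stieltjesWigert_discrete_moment (q : ℝ) (hq0 : 0 < q) (hq1 : q < 1) (n : ℕ) :
    HasSum (fun k : ℤ => q ^ (((k : ℝ) ^ 2) / 2 + ((n : ℝ) + 1) * (k : ℝ)))
        (q ^ ((1 - ((n : ℝ) + 1) ^ 2) / 2) *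
          (qPochInf (-(q ^ ((3 : ℝ) / 2))) q * qPochInf (-(q ^ (-(1 : ℝ) / 2))) q *
            qPochInf q q)) ∧
      (1 / (Real.sqrt q *
            (qPochInf (-(q ^ ((3 : ℝ) / 2))) q * qPochInf (-(q ^ (-(1 : ℝ) / 2))) q *
              qPochInf q q))) *
          ∑' k : ℤ, q ^ ((n : ℝ) * (k : ℝ)) * q ^ ((k : ℝ) + ((k : ℝ) ^ 2) / 2) =
        q ^ (-(((n : ℝ) + 1) ^ 2) / 2) := by
  set M := qPochInf (-(q ^ ((3 : ℝ) / 2))) q * qPochInf (-(q ^ (-(1 : ℝ) / 2))) q *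
    qPochInf q q with hM
  set m : ℝ := (n : ℝ) + 1 with hm
  have hp0 : 0 < q ^ ((1 : ℝ) / 2) := Real.rpow_pos_of_pos hq0 _
  have hp1 : q ^ ((1 : ℝ) / 2) < 1 := Real.rpow_lt_one hq0.le hq1 (by norm_num)
  have hp2 : (q ^ ((1 : ℝ) / 2)) ^ 2 = q := by
    rw [← Real.rpow_mul_natCast hq0.le]
    norm_num
  have hsum : HasSum (fun k : ℤ => q ^ ((k : ℝ) ^ 2 / 2 + m * k)) (q ^ ((1 - m ^ 2) / 2) * M) := by
    have h := hasSum_pow_natAbs_sq hp0 hp1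
    rw [hp2, ← (Equiv.addRight ((n : ℤ) + 1)).hasSum_iff] at h
    convert h.mul_left (q ^ (-m ^ 2 / 2)) using 1
    · rfl
    · funext k
      simp only [Function.comp, Equiv.coe_addRight]
      rw [← Real.rpow_mul_natCast hq0.le, ← Real.rpow_add hq0]
      congr 1
      rw [Nat.cast_pow, Nat.cast_natAbs, Int.cast_abs, sq_abs]
      push_cast
      ring
    · rw [hM, qPochInf_mul_qPochInf hq0 hq1, ← mul_assoc, ← mul_assoc, ← mul_assoc,
        ← Real.rpow_add hq0]
      congr 3
      ring
  refine ⟨hsum, ?_⟩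
  have hM0 : M ≠ 0 := by
    have h : 0 < q ^ ((1 - m ^ 2) / 2) * M := by
      rw [← hsum.tsum_eq]
      exact hsum.summable.tsum_pos (fun _ => (Real.rpow_pos_of_pos hq0 _).le) 0
        (Real.rpow_pos_of_pos hq0 _)
    exact right_ne_zero_of_mul h.ne'
  have hterm (k : ℤ) : q ^ ((n : ℝ) * k) * q ^ ((k : ℝ) + (k : ℝ) ^ 2 / 2) =
      q ^ ((k : ℝ) ^ 2 / 2 + m * k) := by
    rw [← Real.rpow_add hq0]
    congr 1
    rw [hm]
    ring
  have hsplit : q ^ ((1 - m ^ 2) / 2) = q ^ ((1 : ℝ) / 2) * q ^ (-m ^ 2 / 2) := by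
    rw [← Real.rpow_add hq0]
    congr 1
    ring
  rw [tsum_congr hterm, hsum.tsum_eq, Real.sqrt_eq_rpow, hsplit]
  field_simp
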